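/- arXiv:0704.0337 — 11 statements merged into one kernel-verified Lean document; each statement's English description precedes it below -/
import Mathlib

section
/- Along any solution of the complex three-wave resonant Euler system, the Manley–Rowe cubic invariant Re(U_n(t)·conj(U_k(t))·conj(U_m(t))) is constant in t; equivalently, writing U_j = r_j e^{iθ_j}, the quantity r_k r_m r_n cos(θ_n − θ_k − θ_m) is a first integral. -/
/-- Along any solution of the complex three-wave resonant Euler system, the
Manley–Rowe cubic invariant `Re(U_n · conj(U_k) · conj(U_m))` is constant in time
(equivalently, writing `U_j = r_j e^{iθ_j}`, the quantity
`r_k r_m r_n cos(θ_n − θ_k − θ_m)` is a first integral). -/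
theorem manley_rowe_cubic_invariant_complex_three_wave
    (lk lm ln : ℝ) (hkm : lk ≠ lm) (hmn : lm ≠ ln) (hkn : lk ≠ ln)
    (Uk Um Un : ℝ → ℂ)
    (hUn : ∀ t, HasDerivAt Un (-Complex.I * ((lk : ℂ) - lm) * Uk t * Um t) t)
    (hUk : ∀ t, HasDerivAt Uk (Complex.I * ((lm : ℂ) - ln) * Un t * (starRingEnd ℂ) (Um t)) t)
    (hUm : ∀ t, HasDerivAt Um (Complex.I * ((ln : ℂ) - lk) * Un t * (starRingEnd ℂ) (Uk t)) t) :
    ∀ t : ℝ, (Un t * (starRingEnd ℂ) (Uk t) * (starRingEnd ℂ) (Um t)).re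
      = (Un 0 * (starRingEnd ℂ) (Uk 0) * (starRingEnd ℂ) (Um 0)).re := by
  have hderiv : ∀ t, HasDerivAt
      (fun s => (Un s * (starRingEnd ℂ) (Uk s) * (starRingEnd ℂ) (Um s)).re) 0 t := by
    intro t
    have h := Complex.reCLM.hasFDerivAt.comp_hasDerivAt t
      (((hUn t).mul (hUk t).star).mul (hUm t).star)
    refine h.congr_deriv ?_
    simp
    ring
  intro t
  exact is_const_of_deriv_eq_zero (fun s => (hderiv s).differentiableAt)
    (fun s => (hderiv s).deriv) t 0
end

section
/- Let (p, q, r) be a solution of the real three-wave resonant Euler system with pairwise distinct λ, μ, ν, and let E, H be the (constant) energy and helicity. Then the enstrophy Ξ(t) = λ²p(t)² + μ²q(t)² + ν²r(t)² is twice differentiable and satisfies the second-order ODE Ξ'' = −2K·P'(Ξ), where P(X) = (X−x₋)(X−x₀)(X₊−X)·(−1) = (X−x₋)(X−x₀)(X−x₊) with x₋ = (μ+ν)H − μνE, x₀ = (λ+μ)H − λμE, x₊ = (λ+ν)H − λνE, and K = (λ²(μ−ν) + μ²(ν−λ) + ν²(λ−μ))/((λ−μ)(λ−ν)(μ−ν)).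 -/
/-- If `x, y, z` have derivatives `a y z`, `b z x`, `c x y` and `α a + β b + γ c = 0`, then
`α x² + β y² + γ z²` is constant. -/
theorem weighted_sq_sum_eq_of_euler {x y z : ℝ → ℝ} {a b c α β γ : ℝ}
    (hx : ∀ t, HasDerivAt x (a * y t * z t) t)
    (hy : ∀ t, HasDerivAt y (b * z t * x t) t)
    (hz : ∀ t, HasDerivAt z (c * x t * y t) t)
    (h : α * a + β * b + γ * c = 0) (s t : ℝ) :
    α * x s ^ 2 + β * y s ^ 2 + γ * z s ^ 2 = α * x t ^ 2 + β * y t ^ 2 + γ * z t ^ 2 := by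
  have hd : ∀ u, HasDerivAt (fun u => α * x u ^ 2 + β * y u ^ 2 + γ * z u ^ 2) 0 u := by
    intro u
    refine HasDerivAt.congr_deriv
      (((((hx u).pow 2).const_mul α).add (((hy u).pow 2).const_mul β)).add
      (((hz u).pow 2).const_mul γ)) ?_
    push_cast
    linear_combination 2 * x u * y u * z u * h
  exact is_const_of_deriv_eq_zero (fun u => (hd u).differentiableAt) (fun u => (hd u).deriv) s t

/-- Along a solution of the real three-wave resonant Euler system, the enstrophy
`Ξ(t) = λ²p(t)² + μ²q(t)² + ν²r(t)²` is twice differentiable and satisfies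
the second-order ODE `Ξ'' = −2K·P'(Ξ)`, where
`P(X) = (X−x₋)(X−x₀)(X−x₊)` with `x₋ = (μ+ν)H − μνE`, `x₀ = (λ+μ)H − λμE`,
`x₊ = (λ+ν)H − λνE`, and
`K = (λ²(μ−ν) + μ²(ν−λ) + ν²(λ−μ))/((λ−μ)(λ−ν)(μ−ν))`. -/
theorem enstrophy_second_order_ode
    (l m n : ℝ) (hlm : l ≠ m) (hmn : m ≠ n) (hln : l ≠ n)
    (p q r : ℝ → ℝ)
    (hp : ∀ t, HasDerivAt p (-(m - n) * q t * r t) t)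
    (hq : ∀ t, HasDerivAt q (-(n - l) * r t * p t) t)
    (hr : ∀ t, HasDerivAt r (-(l - m) * p t * q t) t)
    (E H : ℝ)
    (hE : E = p 0 ^ 2 + q 0 ^ 2 + r 0 ^ 2)
    (hH : H = l * p 0 ^ 2 + m * q 0 ^ 2 + n * r 0 ^ 2)
    (Ξ : ℝ → ℝ)
    (hΞ : Ξ = fun t => l ^ 2 * p t ^ 2 + m ^ 2 * q t ^ 2 + n ^ 2 * r t ^ 2)
    (xm x0 xp K : ℝ)
    (hxm : xm = (m + n) * H - m * n * E)
    (hx0 : x0 = (l + m) * H - l * m * E)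
    (hxp : xp = (l + n) * H - l * n * E)
    (hK : K = (l ^ 2 * (m - n) + m ^ 2 * (n - l) + n ^ 2 * (l - m))
          / ((l - m) * (l - n) * (m - n))) :
    (∀ t, DifferentiableAt ℝ Ξ t) ∧ (∀ t, DifferentiableAt ℝ (deriv Ξ) t) ∧
    (∀ t, deriv (deriv Ξ) t
        = -2 * K * ((Ξ t - x0) * (Ξ t - xp) + (Ξ t - xm) * (Ξ t - xp)
            + (Ξ t - xm) * (Ξ t - x0))) := by
  have hΞ' : ∀ t, HasDerivAt Ξ (-2 * ((l - m) * (l - n) * (m - n)) * (p t * q t * r t)) t := by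
    intro t
    rw [hΞ]
    refine HasDerivAt.congr_deriv
      (((((hp t).pow 2).const_mul (l ^ 2)).add (((hq t).pow 2).const_mul (m ^ 2))).add
      (((hr t).pow 2).const_mul (n ^ 2))) ?_
    push_cast
    ring
  have hderiv : deriv Ξ = fun t => -2 * ((l - m) * (l - n) * (m - n)) * (p t * q t * r t) :=
    funext fun t => (hΞ' t).deriv
  have hΞ'' : ∀ t, HasDerivAt (deriv Ξ) (2 * ((l - m) * (l - n) * (m - n)) *
      ((m - n) * (q t * r t) ^ 2 + (n - l) * (r t * p t) ^ 2 + (l - m) * (p t * q t) ^ 2)) t := by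
    intro t
    rw [hderiv]
    refine HasDerivAt.congr_deriv ((((hp t).mul (hq t)).mul (hr t)).const_mul _) ?_
    simp only [Pi.mul_apply]
    ring
  refine ⟨fun t => (hΞ' t).differentiableAt, fun t => (hΞ'' t).differentiableAt, fun t => ?_⟩
  have hEt : E = p t ^ 2 + q t ^ 2 + r t ^ 2 := by
    have h := weighted_sq_sum_eq_of_euler (α := 1) (β := 1) (γ := 1) hp hq hr (by ring) 0 t
    linarith
  have hHt : H = l * p t ^ 2 + m * q t ^ 2 + n * r t ^ 2 :=
    hH.trans (weighted_sq_sum_eq_of_euler hp hq hr (by ring) 0 t)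
  have hK1 : K = 1 := by
    rw [hK, div_eq_one_iff_eq (mul_ne_zero (mul_ne_zero (sub_ne_zero.2 hlm) (sub_ne_zero.2 hln))
      (sub_ne_zero.2 hmn))]
    ring
  have hΞxm : Ξ t - xm = (l - m) * (l - n) * p t ^ 2 := by
    rw [hΞ, hxm, hEt, hHt]; ring
  have hΞx0 : Ξ t - x0 = (n - l) * (n - m) * r t ^ 2 := by
    rw [hΞ, hx0, hEt, hHt]; ring
  have hΞxp : Ξ t - xp = (m - l) * (m - n) * q t ^ 2 := by
    rw [hΞ, hxp, hEt, hHt]; ring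
  rw [(hΞ'' t).deriv, hK1, hΞxm, hΞx0, hΞxp]
  ring
end

section
/- Let (p, q, r) be a solution of the real three-wave resonant Euler system with pairwise distinct λ, μ, ν and r(0) = 0. Then Ξ(0) = x₀ and for all t the enstrophy satisfies the first-order relation (Ξ'(t))² = −4K·P(Ξ(t)), where P(X) = (X−x₋)(X−x₀)(X−x₊) with x₋ = (μ+ν)H − μνE, x₀ = (λ+μ)H − λμE, x₊ = (λ+ν)H − λνE computed from the conserved energy E and helicity H, and K = (λ²(μ−ν) + μ²(ν−λ) + ν²(λ−μ))/((λ−μ)(λ−ν)(μ−ν)). -/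
/-- A weighted sum of squares of a solution of the three-wave system has derivative proportional
to `p q r`. -/
theorem hasDerivAt_weighted_energy {l m n : ℝ} {p q r : ℝ → ℝ} {t : ℝ}
    (hp : HasDerivAt p (-(m - n) * q t * r t) t)
    (hq : HasDerivAt q (-(n - l) * r t * p t) t)
    (hr : HasDerivAt r (-(l - m) * p t * q t) t) (a b c : ℝ) :
    HasDerivAt (fun s => a * p s ^ 2 + b * q s ^ 2 + c * r s ^ 2)
      (-2 * (a * (m - n) + b * (n - l) + c * (l - m)) * (p t * q t * r t)) t := by
  have h := (((hp.pow 2).const_mul a).add ((hq.pow 2).const_mul b)).add ((hr.pow 2).const_mul c)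
  refine h.congr_deriv ?_
  push_cast
  ring

/-- A weighted sum of squares whose weights are orthogonal to the interaction coefficients is
conserved by the three-wave system. -/
theorem weighted_energy_eq_initial {l m n : ℝ} {p q r : ℝ → ℝ}
    (hp : ∀ t, HasDerivAt p (-(m - n) * q t * r t) t)
    (hq : ∀ t, HasDerivAt q (-(n - l) * r t * p t) t)
    (hr : ∀ t, HasDerivAt r (-(l - m) * p t * q t) t) {a b c : ℝ}
    (habc : a * (m - n) + b * (n - l) + c * (l - m) = 0) (t : ℝ) :
    a * p t ^ 2 + b * q t ^ 2 + c * r t ^ 2 = a * p 0 ^ 2 + b * q 0 ^ 2 + c * r 0 ^ 2 := by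
  have h t := hasDerivAt_weighted_energy (hp t) (hq t) (hr t) a b c
  refine is_const_of_deriv_eq_zero (fun s => (h s).differentiableAt) (fun s => ?_) t 0
  rw [(h s).deriv, habc]
  ring

/-- For a solution of the real three-wave resonant Euler system with `r(0) = 0`,
one has `Ξ(0) = x₀` and the first-order relation `(Ξ')² = −4K·P(Ξ)`, where
`P(X) = (X−x₋)(X−x₀)(X−x₊)` with `x₋ = (μ+ν)H − μνE`, `x₀ = (λ+μ)H − λμE`,
`x₊ = (λ+ν)H − λνE` computed from the conserved energy and helicity, and
`K = (λ²(μ−ν) + μ²(ν−λ) + ν²(λ−μ))/((λ−μ)(λ−ν)(μ−ν))`. -/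
theorem enstrophy_first_order_relation
    (l m n : ℝ) (hlm : l ≠ m) (hmn : m ≠ n) (hln : l ≠ n)
    (p q r : ℝ → ℝ)
    (hp : ∀ t, HasDerivAt p (-(m - n) * q t * r t) t)
    (hq : ∀ t, HasDerivAt q (-(n - l) * r t * p t) t)
    (hr : ∀ t, HasDerivAt r (-(l - m) * p t * q t) t)
    (hr0 : r 0 = 0)
    (E H : ℝ)
    (hE : E = p 0 ^ 2 + q 0 ^ 2 + r 0 ^ 2)
    (hH : H = l * p 0 ^ 2 + m * q 0 ^ 2 + n * r 0 ^ 2)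
    (Ξ : ℝ → ℝ)
    (hΞ : Ξ = fun t => l ^ 2 * p t ^ 2 + m ^ 2 * q t ^ 2 + n ^ 2 * r t ^ 2)
    (xm x0 xp K : ℝ)
    (hxm : xm = (m + n) * H - m * n * E)
    (hx0 : x0 = (l + m) * H - l * m * E)
    (hxp : xp = (l + n) * H - l * n * E)
    (hK : K = (l ^ 2 * (m - n) + m ^ 2 * (n - l) + n ^ 2 * (l - m))
          / ((l - m) * (l - n) * (m - n))) :
    Ξ 0 = x0 ∧
    ∀ t, (deriv Ξ t) ^ 2 = -4 * K * ((Ξ t - xm) * (Ξ t - x0) * (Ξ t - xp)) := by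
  have hE' t : p t ^ 2 + q t ^ 2 + r t ^ 2 = E := by
    have h := weighted_energy_eq_initial hp hq hr (a := 1) (b := 1) (c := 1) (by ring) t
    linarith
  have hH' t : l * p t ^ 2 + m * q t ^ 2 + n * r t ^ 2 = H :=
    (weighted_energy_eq_initial hp hq hr (by ring) t).trans hH.symm
  have hK1 : K = 1 := by
    rw [hK, div_eq_one_iff_eq (mul_ne_zero (mul_ne_zero (sub_ne_zero.2 hlm) (sub_ne_zero.2 hln))
      (sub_ne_zero.2 hmn))]
    ring
  refine ⟨?_, fun t => ?_⟩
  · simp only [hΞ, hx0, hE, hH, hr0]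
    ring
  · rw [hΞ, (hasDerivAt_weighted_energy (hp t) (hq t) (hr t) _ _ _).deriv, hxm, hx0, hxp, hK1,
      ← hE' t, ← hH' t]
    ring
end

section
/- Let λ > μ > ν be reals and set c = √((λ−μ)(μ−ν)). Then the functions p(t) = √((μ−ν)/(λ−ν))·sech(ct), q(t) = tanh(ct), r(t) = √((λ−μ)/(λ−ν))·sech(ct) form a solution of the real three-wave resonant Euler system lying on the unit energy sphere (p(t)² + q(t)² + r(t)² = 1 for all t), and this solution is a heteroclinic connection: (p(t), q(t), r(t)) → (0, −1, 0) as t → −∞ and (p(t), q(t), r(t)) → (0, 1, 0) as t → +∞. -/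
open Filter Topology in
lemma tendsto_cosh_atTop : Tendsto Real.cosh atTop atTop := by
  refine tendsto_atTop_mono (fun x => ?_) (Real.tendsto_exp_atTop.atTop_div_const two_pos)
  rw [Real.cosh_eq]
  linarith [Real.exp_pos (-x)]

open Filter Topology in
lemma tendsto_one_div_cosh_atTop : Tendsto (fun x => 1 / Real.cosh x) atTop (𝓝 0) := by
  simp only [one_div]
  exact tendsto_cosh_atTop.inv_tendsto_atTop

open Filter Topology in
lemma tendsto_tanh_atTop : Tendsto Real.tanh atTop (𝓝 1) := by
  have h : Real.tanh = fun x => 1 - Real.exp (-x) * (1 / Real.cosh x) := by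
    funext x
    rw [Real.tanh_eq_sinh_div_cosh, ← Real.cosh_sub_sinh]
    field_simp [(Real.cosh_pos x).ne']
    ring
  rw [h]
  simpa using (Real.tendsto_exp_neg_atTop_nhds_zero.mul tendsto_one_div_cosh_atTop).const_sub 1

open Filter Topology in
lemma tendsto_one_div_cosh_atBot : Tendsto (fun x => 1 / Real.cosh x) atBot (𝓝 0) := by
  simpa [Function.comp_def] using tendsto_one_div_cosh_atTop.comp tendsto_neg_atBot_atTop

open Filter Topology in
lemma tendsto_tanh_atBot : Tendsto Real.tanh atBot (𝓝 (-1)) := by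
  simpa [Function.comp_def] using (tendsto_tanh_atTop.comp tendsto_neg_atBot_atTop).neg

lemma hasDerivAt_one_div_cosh_mul (c t : ℝ) :
    HasDerivAt (fun t => 1 / Real.cosh (c * t))
      (-(c * Real.tanh (c * t) * (1 / Real.cosh (c * t)))) t := by
  have h := (((hasDerivAt_id t).const_mul c).cosh).inv (Real.cosh_pos (c * t)).ne'
  simp only [one_div]
  refine h.congr_deriv ?_
  rw [Real.tanh_eq_sinh_div_cosh]
  simp only [id]
  field_simp [(Real.cosh_pos (c * t)).ne']

lemma hasDerivAt_tanh_mul (c t : ℝ) :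
    HasDerivAt (fun t => Real.tanh (c * t)) (c * (1 / Real.cosh (c * t)) ^ 2) t := by
  have hd := (hasDerivAt_id t).const_mul c
  have h := hd.sinh.div hd.cosh (Real.cosh_pos (c * t)).ne'
  simp only [Real.tanh_eq_sinh_div_cosh]
  refine h.congr_deriv ?_
  simp only [id]
  field_simp [(Real.cosh_pos (c * t)).ne']
  linear_combination c * Real.cosh_sq_sub_sinh_sq (c * t)

/-- With `λ > μ > ν` and `c = √((λ−μ)(μ−ν))`, the functions
`p(t) = √((μ−ν)/(λ−ν))·sech(ct)`, `q(t) = tanh(ct)`,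
`r(t) = √((λ−μ)/(λ−ν))·sech(ct)` solve the real three-wave resonant Euler
system, lie on the unit energy sphere, and form a heteroclinic connection
from `(0,−1,0)` (as `t → −∞`) to `(0,1,0)` (as `t → +∞`). -/
theorem heteroclinic_connection_three_wave
    (l m n : ℝ) (hlm : m < l) (hmn : n < m)
    (c : ℝ) (hc : c = Real.sqrt ((l - m) * (m - n)))
    (p q r : ℝ → ℝ)
    (hpdef : p = fun t => Real.sqrt ((m - n) / (l - n)) * (1 / Real.cosh (c * t)))
    (hqdef : q = fun t => Real.tanh (c * t))
    (hrdef : r = fun t => Real.sqrt ((l - m) / (l - n)) * (1 / Real.cosh (c * t))) :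
    (∀ t, HasDerivAt p (-(m - n) * q t * r t) t) ∧
    (∀ t, HasDerivAt q (-(n - l) * r t * p t) t) ∧
    (∀ t, HasDerivAt r (-(l - m) * p t * q t) t) ∧
    (∀ t, p t ^ 2 + q t ^ 2 + r t ^ 2 = 1) ∧
    Filter.Tendsto (fun t => (p t, q t, r t)) Filter.atBot
      (nhds ((0 : ℝ), (-1 : ℝ), (0 : ℝ))) ∧
    Filter.Tendsto (fun t => (p t, q t, r t)) Filter.atTop
      (nhds ((0 : ℝ), (1 : ℝ), (0 : ℝ))) := by
  have hm : 0 < m - n := sub_pos.2 hmn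
  have hl : 0 < l - m := sub_pos.2 hlm
  have hs : 0 < l - n := by linarith
  have hc0 : 0 < c := hc ▸ Real.sqrt_pos.2 (mul_pos hl hm)
  rw [Real.sqrt_mul hl.le] at hc
  rw [Real.sqrt_div hm.le] at hpdef
  rw [Real.sqrt_div hl.le] at hrdef
  have ha2 := Real.sq_sqrt hm.le
  have hb2 := Real.sq_sqrt hl.le
  have hs2 := Real.sq_sqrt hs.le
  have hs0 := (Real.sqrt_pos.2 hs).ne'
  set a := √(m - n)
  set b := √(l - m)
  set s := √(l - n)
  have hac : a / s * c = (m - n) * (b / s) := by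
    rw [hc, ← ha2]
    ring
  have hbc : b / s * c = (l - m) * (a / s) := by
    rw [hc, ← hb2]
    ring
  have habc : c = (l - n) * (a / s) * (b / s) := by
    rw [hc, ← hs2]
    field_simp
  have hab : (a / s) ^ 2 + (b / s) ^ 2 = 1 := by
    field_simp
    linarith
  subst hpdef hqdef hrdef
  have hbot : Filter.Tendsto (fun t => c * t) Filter.atBot Filter.atBot :=
    Filter.tendsto_id.const_mul_atBot hc0
  have htop : Filter.Tendsto (fun t => c * t) Filter.atTop Filter.atTop :=
    Filter.tendsto_id.const_mul_atTop hc0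
  refine ⟨fun t => ?_, fun t => ?_, fun t => ?_, fun t => ?_, ?_, ?_⟩
  · refine ((hasDerivAt_one_div_cosh_mul c t).const_mul (a / s)).congr_deriv ?_
    linear_combination -(Real.tanh (c * t) * (1 / Real.cosh (c * t))) * hac
  · refine (hasDerivAt_tanh_mul c t).congr_deriv ?_
    linear_combination (1 / Real.cosh (c * t)) ^ 2 * habc
  · refine ((hasDerivAt_one_div_cosh_mul c t).const_mul (b / s)).congr_deriv ?_
    linear_combination -(Real.tanh (c * t) * (1 / Real.cosh (c * t))) * hbc
  · have h : Real.tanh (c * t) ^ 2 + (1 / Real.cosh (c * t)) ^ 2 = 1 := by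
      rw [Real.tanh_eq_sinh_div_cosh]
      field_simp [(Real.cosh_pos (c * t)).ne']
      linarith [Real.cosh_sq (c * t)]
    linear_combination (1 / Real.cosh (c * t)) ^ 2 * hab + h
  · have h := tendsto_one_div_cosh_atBot.comp hbot
    refine Filter.Tendsto.prodMk_nhds ?_
      ((tendsto_tanh_atBot.comp hbot).prodMk_nhds ?_)
    · simpa only [mul_zero, Function.comp_def] using h.const_mul (a / s)
    · simpa only [mul_zero, Function.comp_def] using h.const_mul (b / s)
  · have h := tendsto_one_div_cosh_atTop.comp htop
    refine Filter.Tendsto.prodMk_nhds ?_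
      ((tendsto_tanh_atTop.comp htop).prodMk_nhds ?_)
    · simpa only [mul_zero, Function.comp_def] using h.const_mul (a / s)
    · simpa only [mul_zero, Function.comp_def] using h.const_mul (b / s)
end

section
/- Let (p, q, r) be a solution of the real three-wave resonant Euler system with λ > μ > ν, r(0) = 0, p(0) ≠ 0 and q(0) ≠ 0, and let E, H be the conserved energy and helicity. Then x₋ < x₀ < x₊, where x₋ = (μ+ν)H − μνE, x₀ = (λ+μ)H − λμE, x₊ = (λ+ν)H − λνE, and there exists a time t* with 0 < t* ≤ T := (1/(2√K))·∫_{x₀}^{x₊} dx/√(−P(x)) at which the enstrophy attains its maximal value: Ξ(t*) = x₊; here P(X) = (X−x₋)(X−x₀)(X−x₊) and K = (λ²(μ−ν) + μ²(ν−λ) + ν²(λ−μ))/((λ−μ)(λ−ν)(μ−ν)). -/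
open MeasureTheory Set

/-- Elliptic integrals of the first kind converge at both ends of the oscillation interval. -/
theorem intervalIntegrable_one_div_sqrt_neg_cubic {a b c : ℝ} (hab : a < b) (hbc : b < c) :
    IntervalIntegrable (fun x => 1 / Real.sqrt (-((x - a) * (x - b) * (x - c)))) volume b c := by
  have hd : 0 < c - b := sub_pos.2 hbc
  have arcsine : IntervalIntegrable (fun x => 1 / Real.sqrt ((x - b) * (c - x))) volume b c := by
    apply intervalIntegral.intervalIntegrable_deriv_of_nonneg
      (g := fun x => Real.arcsin ((2 * x - b - c) / (c - b)))
    · exact (Real.continuous_arcsin.comp (by fun_prop)).continuousOn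
    · intro x hx
      rw [min_eq_left hbc.le, max_eq_right hbc.le] at hx
      have hlin : HasDerivAt (fun x : ℝ => (2 * x - b - c) / (c - b)) (2 / (c - b)) x := by
        simpa using ((((hasDerivAt_id x).const_mul 2).sub_const b).sub_const c).div_const (c - b)
      have h1 : (2 * x - b - c) / (c - b) ≠ -1 := by
        rw [ne_eq, div_eq_iff hd.ne']
        intro h
        linarith [hx.1]
      have h2 : (2 * x - b - c) / (c - b) ≠ 1 := by
        rw [ne_eq, div_eq_iff hd.ne']
        intro h
        linarith [hx.2]
      have h := (Real.hasDerivAt_arcsin h1 h2).comp x hlin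
      refine h.congr_deriv ?_
      have hsq : 1 - ((2 * x - b - c) / (c - b)) ^ 2 =
          (2 / (c - b)) ^ 2 * ((x - b) * (c - x)) := by
        field_simp
        ring
      have hpos : 0 < Real.sqrt ((x - b) * (c - x)) :=
        Real.sqrt_pos.2 (mul_pos (sub_pos.2 hx.1) (sub_pos.2 hx.2))
      rw [hsq, Real.sqrt_mul (sq_nonneg _), Real.sqrt_sq (by positivity)]
      field_simp
    · intro x _
      positivity
  have hcont : ContinuousOn (fun x => 1 / Real.sqrt (x - a)) (uIcc b c) := by
    rw [uIcc_of_le hbc.le]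
    refine continuousOn_const.div (by fun_prop) fun x hx => ?_
    exact (Real.sqrt_pos.2 (by linarith [hx.1])).ne'
  refine IntervalIntegrable.congr ?_ (arcsine.continuousOn_mul hcont)
  intro x hx
  rw [uIoc_of_le hbc.le] at hx
  have hxa : 0 ≤ x - a := by linarith [hx.1]
  beta_reduce
  rw [show -((x - a) * (x - b) * (x - c)) = (x - a) * ((x - b) * (c - x)) by ring,
    Real.sqrt_mul hxa, one_div_mul_one_div]

theorem eq_of_forall_hasDerivAt_zero {f : ℝ → ℝ} (hf : ∀ t, HasDerivAt f 0 t) (s t : ℝ) :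
    f s = f t :=
  is_const_of_deriv_eq_zero (fun t => (hf t).differentiableAt) (fun t => (hf t).deriv) s t

/-- A function that starts at a zero of a cubic, is increasing while strictly below the next zero,
and solves `y' ^ 2 = -4 P(y)`, cannot stay below that zero up to the time given by half the
elliptic integral. -/
theorem half_elliptic_integral_lt_of_lt {a b c T : ℝ} (hab : a < b) (hbc : b < c)
    {y y' : ℝ → ℝ} (hT : 0 ≤ T) (hy : ∀ t, HasDerivAt y (y' t) t) (hy0 : y 0 = b)
    (hlt : ∀ t ∈ Ioc 0 T, b < y t ∧ y t < c) (hpos : ∀ t ∈ Ioc 0 T, 0 < y' t)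
    (hode : ∀ t, y' t ^ 2 = -4 * ((y t - a) * (y t - b) * (y t - c))) :
    T < 1 / 2 * ∫ x in b..c, 1 / Real.sqrt (-((x - a) * (x - b) * (x - c))) := by
  set f : ℝ → ℝ := fun x => 1 / Real.sqrt (-((x - a) * (x - b) * (x - c))) with hf
  have hint : IntervalIntegrable f volume b c := intervalIntegrable_one_div_sqrt_neg_cubic hab hbc
  have hmeas : Measurable f := by fun_prop
  have hcubic : ∀ x ∈ Ioo b c, 0 < -((x - a) * (x - b) * (x - c)) := fun x hx => by
    have := mul_pos (mul_pos (sub_pos.2 (hab.trans hx.1)) (sub_pos.2 hx.1)) (sub_pos.2 hx.2)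
    linarith
  have hfpos : ∀ x ∈ Ioo b c, 0 < f x := fun x hx =>
    one_div_pos.2 (Real.sqrt_pos.2 (hcubic x hx))
  have hsub : ∀ x ∈ Icc b c, IntervalIntegrable f volume b x ∧ IntervalIntegrable f volume x c := by
    intro x hx
    constructor <;> refine hint.mono_set ?_ <;>
      rw [uIcc_of_le hbc.le] <;> [rw [uIcc_of_le hx.1]; rw [uIcc_of_le hx.2]]
    · exact Icc_subset_Icc_right hx.2
    · exact Icc_subset_Icc_left hx.1
  have hyT : y T ∈ Ico b c := by
    rcases hT.eq_or_lt with h | h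
    · rw [← h, hy0]
      exact ⟨le_rfl, hbc⟩
    · exact ⟨(hlt T ⟨h, le_rfl⟩).1.le, (hlt T ⟨h, le_rfl⟩).2⟩
  have hmaps : MapsTo y (Icc 0 T) (uIcc b c) := by
    intro t ht
    rw [uIcc_of_le hbc.le]
    rcases ht.1.eq_or_lt with h | h
    · rw [← h, hy0]
      exact ⟨le_rfl, hbc.le⟩
    · exact ⟨(hlt t ⟨h, ht.2⟩).1.le, (hlt t ⟨h, ht.2⟩).2.le⟩
  have hprim : ContinuousOn (fun x => ∫ u in b..x, f u) (uIcc b c) :=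
    intervalIntegral.continuousOn_primitive_interval' hint left_mem_uIcc
  have hycont : Continuous y := continuous_iff_continuousAt.2 fun t => (hy t).continuousAt
  have hyT_time : ∫ u in b..y T, f u = 2 * T := by
    rcases hT.eq_or_lt with h | h
    · rw [← h, hy0, intervalIntegral.integral_same, mul_zero]
    have hderiv : ∀ t ∈ Ioo 0 T, HasDerivAt (fun t => ∫ u in b..y t, f u) 2 t := by
      intro t ht
      have hyt := hlt t ⟨ht.1, ht.2.le⟩
      have hP := hcubic _ hyt
      have hfcont : ContinuousAt f (y t) := by
        refine ContinuousAt.div continuousAt_const ?_ (Real.sqrt_pos.2 hP).ne'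
        fun_prop
      have hF : HasDerivAt (fun x => ∫ u in b..x, f u) (f (y t)) (y t) :=
        intervalIntegral.integral_hasDerivAt_right (hsub _ ⟨hyt.1.le, hyt.2.le⟩).1
          hmeas.stronglyMeasurable.stronglyMeasurableAtFilter hfcont
      refine (hF.comp t (hy t)).congr_deriv ?_
      have hd := hpos t ⟨ht.1, ht.2.le⟩
      have hsqrt : Real.sqrt (-((y t - a) * (y t - b) * (y t - c))) = y' t / 2 := by
        rw [Real.sqrt_eq_iff_mul_self_eq hP.le (by positivity)]
        linarith [hode t]
      simp only [hf, hsqrt]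
      field_simp
    obtain ⟨t, -, ht⟩ := exists_hasDerivAt_eq_slope (fun t => ∫ u in b..y t, f u) (fun _ => 2) h
      (hprim.comp hycont.continuousOn hmaps) hderiv
    rw [eq_div_iff (by linarith), hy0, intervalIntegral.integral_same] at ht
    linarith
  have hrest : 0 < ∫ u in y T..c, f u :=
    intervalIntegral.intervalIntegral_pos_of_pos_on (hsub _ ⟨hyT.1, hyT.2.le⟩).2
      (fun x hx => hfpos x ⟨hyT.1.trans_lt hx.1, hx.2⟩) hyT.2
  have hsplit := intervalIntegral.integral_add_adjacent_intervals
    (hsub _ ⟨hyT.1, hyT.2.le⟩).1 (hsub _ ⟨hyT.1, hyT.2.le⟩).2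
  linarith


/-- For a solution of the real three-wave resonant Euler system with
`λ > μ > ν`, `r(0) = 0`, `p(0) ≠ 0`, `q(0) ≠ 0`, one has `x₋ < x₀ < x₊` and
there is a time `t*` with `0 < t* ≤ T = (1/(2√K))·∫_{x₀}^{x₊} dx/√(−P(x))`
at which the enstrophy attains its maximum: `Ξ(t*) = x₊`.  Here
`P(X) = (X−x₋)(X−x₀)(X−x₊)`, `x₋ = (μ+ν)H − μνE`, `x₀ = (λ+μ)H − λμE`,
`x₊ = (λ+ν)H − λνE`, and
`K = (λ²(μ−ν) + μ²(ν−λ) + ν²(λ−μ))/((λ−μ)(λ−ν)(μ−ν))`. -/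
theorem enstrophy_reaches_maximum_within_half_period
    (l m n : ℝ) (hlm : m < l) (hmn : n < m)
    (p q r : ℝ → ℝ)
    (hp : ∀ t, HasDerivAt p (-(m - n) * q t * r t) t)
    (hq : ∀ t, HasDerivAt q (-(n - l) * r t * p t) t)
    (hr : ∀ t, HasDerivAt r (-(l - m) * p t * q t) t)
    (hr0 : r 0 = 0) (hp0 : p 0 ≠ 0) (hq0 : q 0 ≠ 0)
    (E H : ℝ)
    (hE : E = p 0 ^ 2 + q 0 ^ 2 + r 0 ^ 2)
    (hH : H = l * p 0 ^ 2 + m * q 0 ^ 2 + n * r 0 ^ 2)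
    (Ξ : ℝ → ℝ)
    (hΞ : Ξ = fun t => l ^ 2 * p t ^ 2 + m ^ 2 * q t ^ 2 + n ^ 2 * r t ^ 2)
    (xm x0 xp K : ℝ)
    (hxm : xm = (m + n) * H - m * n * E)
    (hx0 : x0 = (l + m) * H - l * m * E)
    (hxp : xp = (l + n) * H - l * n * E)
    (hK : K = (l ^ 2 * (m - n) + m ^ 2 * (n - l) + n ^ 2 * (l - m))
          / ((l - m) * (l - n) * (m - n))) :
    xm < x0 ∧ x0 < xp ∧
    ∃ tstar : ℝ, 0 < tstar ∧
      tstar ≤ (1 / (2 * Real.sqrt K)) *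
        ∫ x in x0..xp, 1 / Real.sqrt (-((x - xm) * (x - x0) * (x - xp))) ∧
      Ξ tstar = xp := by
  have hlm' := sub_pos.2 hlm
  have hmn' := sub_pos.2 hmn
  have hln' : 0 < l - n := by linarith
  have hK1 : K = 1 := by
    rw [hK, div_eq_one_iff_eq (by positivity)]
    ring
  have hEt : ∀ t, p t ^ 2 + q t ^ 2 + r t ^ 2 = E := by
    intro t
    rw [hE]
    refine eq_of_forall_hasDerivAt_zero (f := fun t => p t ^ 2 + q t ^ 2 + r t ^ 2)
      (fun t => ?_) t 0
    refine ((((hp t).fun_pow 2).fun_add ((hq t).fun_pow 2)).fun_add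
      ((hr t).fun_pow 2)).congr_deriv ?_
    ring
  have hHt : ∀ t, l * p t ^ 2 + m * q t ^ 2 + n * r t ^ 2 = H := by
    intro t
    rw [hH]
    refine eq_of_forall_hasDerivAt_zero
      (f := fun t => l * p t ^ 2 + m * q t ^ 2 + n * r t ^ 2) (fun t => ?_) t 0
    refine (((((hp t).fun_pow 2).const_mul l).fun_add (((hq t).fun_pow 2).const_mul m)).fun_add
      (((hr t).fun_pow 2).const_mul n)).congr_deriv ?_
    ring
  have hΞm : ∀ t, Ξ t - xm = (l - m) * (l - n) * p t ^ 2 := by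
    intro t
    rw [hΞ, hxm, ← hEt t, ← hHt t]
    ring
  have hΞ0 : ∀ t, Ξ t - x0 = (l - n) * (m - n) * r t ^ 2 := by
    intro t
    rw [hΞ, hx0, ← hEt t, ← hHt t]
    ring
  have hΞp : ∀ t, xp - Ξ t = (l - m) * (m - n) * q t ^ 2 := by
    intro t
    rw [hΞ, hxp, ← hEt t, ← hHt t]
    ring
  have hΞ_zero : Ξ 0 = x0 := by
    have := hΞ0 0
    rw [hr0] at this
    linarith
  have hm0 : xm < x0 := by
    have : 0 < (l - m) * (l - n) * p 0 ^ 2 := by positivity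
    linarith [hΞm 0]
  have h0p : x0 < xp := by
    have : 0 < (l - m) * (m - n) * q 0 ^ 2 := by positivity
    linarith [hΞp 0]
  refine ⟨hm0, h0p, ?_⟩
  have hΞderiv : ∀ t,
      HasDerivAt Ξ (-2 * (l - m) * (l - n) * (m - n) * (p t * q t * r t)) t := by
    intro t
    rw [hΞ]
    refine (((((hp t).fun_pow 2).const_mul (l ^ 2)).fun_add
      (((hq t).fun_pow 2).const_mul (m ^ 2))).fun_add
      (((hr t).fun_pow 2).const_mul (n ^ 2))).congr_deriv ?_
    ring
  have hode : ∀ t, (-2 * (l - m) * (l - n) * (m - n) * (p t * q t * r t)) ^ 2 =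
      -4 * ((Ξ t - xm) * (Ξ t - x0) * (Ξ t - xp)) := by
    intro t
    rw [hΞm, hΞ0, ← neg_sub xp, hΞp]
    ring
  rw [hK1, Real.sqrt_one, mul_one]
  by_contra! hne
  set T := 1 / 2 * ∫ x in x0..xp, 1 / Real.sqrt (-((x - xm) * (x - x0) * (x - xp))) with hT
  have hTpos : 0 < T :=
    half_elliptic_integral_lt_of_lt hm0 h0p le_rfl hΞderiv hΞ_zero (by simp) (by simp) hode
  have hpne : ∀ t, p t ≠ 0 := by
    intro t ht
    have h1 := hΞm t
    have h2 : 0 ≤ (l - n) * (m - n) * r t ^ 2 := by positivity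
    rw [ht] at h1
    linarith [hΞ0 t]
  have hqne : ∀ t ∈ Icc 0 T, q t ≠ 0 := by
    intro t ht hqt
    rcases ht.1.eq_or_lt with h | h
    · exact hq0 (h ▸ hqt)
    · have h1 := hΞp t
      rw [hqt] at h1
      exact hne t h ht.2 (by linarith)
  have hpc : Continuous p := continuous_iff_continuousAt.2 fun t => (hp t).continuousAt
  have hqc : Continuous q := continuous_iff_continuousAt.2 fun t => (hq t).continuousAt
  have hrc : Continuous r := continuous_iff_continuousAt.2 fun t => (hr t).continuousAt
  have hpq : ∀ t ∈ Icc 0 T, 0 < p 0 * q 0 * (p t * q t) := by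
    intro t ht
    by_contra! hle
    have hcont : ContinuousOn (fun t => p 0 * q 0 * (p t * q t)) (Icc 0 t) := by fun_prop
    obtain ⟨s, hs, hs0⟩ := intermediate_value_Icc' ht.1 hcont
      ⟨hle, mul_self_nonneg (p 0 * q 0)⟩
    exact mul_ne_zero (mul_ne_zero hp0 hq0)
      (mul_ne_zero (hpne s) (hqne s ⟨hs.1, hs.2.trans ht.2⟩)) hs0
  have hrpos : ∀ t ∈ Ioc 0 T, 0 < -(p 0 * q 0) * r t := by
    intro t ht
    obtain ⟨s, hs, hslope⟩ := exists_hasDerivAt_eq_slope (fun t => -(p 0 * q 0) * r t)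
      (fun t => -(p 0 * q 0) * (-(l - m) * p t * q t)) ht.1 (by fun_prop)
      (fun s _ => (hr s).const_mul _)
    have hpos := mul_pos hlm' (hpq s ⟨hs.1.le, hs.2.le.trans ht.2⟩)
    rw [eq_div_iff (by linarith [ht.1]), hr0] at hslope
    have := mul_pos hpos ht.1
    linarith
  have hpqr : ∀ t ∈ Ioc 0 T, p t * q t * r t < 0 := by
    intro t ht
    have h := mul_pos (hpq t ⟨ht.1.le, ht.2⟩) (hrpos t ht)
    have hsq : 0 < (p 0 * q 0) ^ 2 := by positivity
    by_contra! hle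
    have := mul_nonneg hsq.le hle
    linarith
  refine lt_irrefl T (half_elliptic_integral_lt_of_lt hm0 h0p hTpos.le hΞderiv hΞ_zero
    (fun t ht => ⟨?_, ?_⟩) (fun t ht => ?_) hode)
  · have hrne : r t ≠ 0 := right_ne_zero_of_mul (hrpos t ht).ne'
    have : 0 < (l - n) * (m - n) * r t ^ 2 := by positivity
    linarith [hΞ0 t]
  · have hqt := hqne t ⟨ht.1.le, ht.2⟩
    have : 0 < (l - m) * (m - n) * q t ^ 2 := by positivity
    linarith [hΞp t]
  · have h := mul_pos (mul_pos (mul_pos hlm' hln') hmn') (neg_pos.2 (hpqr t ht))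
    linarith
end

section
/- For any pairwise distinct reals λ, μ, ν and any reals p, q, r, setting E = p² + q² + r², H = λp² + μq² + νr², Ξ = λ²p² + μ²q² + ν²r², W = λ⁶p² + μ⁶q² + ν⁶r², x₋ = (μ+ν)H − μνE, x₀ = (λ+μ)H − λμE, x₊ = (λ+ν)H − λνE, one has the identity W = λ⁶(Ξ−x₋)/((λ−μ)(λ−ν)) + μ⁶(Ξ−x₊)/((μ−ν)(μ−λ)) + ν⁶(Ξ−x₀)/((ν−λ)(ν−μ)). Consequently, if λ > μ > ν and Ξ = x₊, then W ≥ λ⁶(x₊−x₋)/((λ−μ)(λ−ν)). -/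
/-- For pairwise distinct `λ, μ, ν` and any `p, q, r`, the squared `H³`
seminorm `W = λ⁶p² + μ⁶q² + ν⁶r²` satisfies
`W = λ⁶(Ξ−x₋)/((λ−μ)(λ−ν)) + μ⁶(Ξ−x₊)/((μ−ν)(μ−λ)) + ν⁶(Ξ−x₀)/((ν−λ)(ν−μ))`;
consequently, if `λ > μ > ν` and `Ξ = x₊`, then
`W ≥ λ⁶(x₊−x₋)/((λ−μ)(λ−ν))`. -/
theorem h3_seminorm_identity_and_burst_bound
    (l m n : ℝ) (hlm : l ≠ m) (hmn : m ≠ n) (hln : l ≠ n)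
    (p q r : ℝ)
    (E H Ξ W : ℝ)
    (hE : E = p ^ 2 + q ^ 2 + r ^ 2)
    (hH : H = l * p ^ 2 + m * q ^ 2 + n * r ^ 2)
    (hΞ : Ξ = l ^ 2 * p ^ 2 + m ^ 2 * q ^ 2 + n ^ 2 * r ^ 2)
    (hW : W = l ^ 6 * p ^ 2 + m ^ 6 * q ^ 2 + n ^ 6 * r ^ 2)
    (xm x0 xp : ℝ)
    (hxm : xm = (m + n) * H - m * n * E)
    (hx0 : x0 = (l + m) * H - l * m * E)
    (hxp : xp = (l + n) * H - l * n * E) :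
    W = l ^ 6 * (Ξ - xm) / ((l - m) * (l - n))
        + m ^ 6 * (Ξ - xp) / ((m - n) * (m - l))
        + n ^ 6 * (Ξ - x0) / ((n - l) * (n - m)) ∧
    (m < l → n < m → Ξ = xp → l ^ 6 * (xp - xm) / ((l - m) * (l - n)) ≤ W) := by
  have hp : l ^ 6 * (Ξ - xm) / ((l - m) * (l - n)) = l ^ 6 * p ^ 2 := by
    rw [div_eq_iff (mul_ne_zero (sub_ne_zero.2 hlm) (sub_ne_zero.2 hln))]
    subst_vars
    ring
  have hq : m ^ 6 * (Ξ - xp) / ((m - n) * (m - l)) = m ^ 6 * q ^ 2 := by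
    rw [div_eq_iff (mul_ne_zero (sub_ne_zero.2 hmn) (sub_ne_zero.2 hlm.symm))]
    subst_vars
    ring
  have hr : n ^ 6 * (Ξ - x0) / ((n - l) * (n - m)) = n ^ 6 * r ^ 2 := by
    rw [div_eq_iff (mul_ne_zero (sub_ne_zero.2 hln.symm) (sub_ne_zero.2 hmn.symm))]
    subst_vars
    ring
  refine ⟨by rw [hp, hq, hr, hW], fun _ _ h => ?_⟩
  rw [← h, hp, hW, add_assoc]
  exact le_add_of_nonneg_right (by positivity)
end

section
/- Along any solution of the coupled rigid-body resonant Euler system, the energy a_k(t)² + a_m(t)² + a_n(t)² + a_m̃(t)² + a_k̃(t)² and the helicity λ_k·a_k(t)² + λ_m·a_m(t)² + λ_n·a_n(t)² + λ_m̃·a_m̃(t)² + λ_k̃·a_k̃(t)² are constant in t. -/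
/-- A weighted sum of squares of five differentiable functions is constant as soon as its formal
derivative vanishes. -/
theorem weighted_sum_sq_eq_of_hasDerivAt (c₁ c₂ c₃ c₄ c₅ : ℝ)
    {f₁ f₂ f₃ f₄ f₅ f₁' f₂' f₃' f₄' f₅' : ℝ → ℝ}
    (h₁ : ∀ t, HasDerivAt f₁ (f₁' t) t) (h₂ : ∀ t, HasDerivAt f₂ (f₂' t) t)
    (h₃ : ∀ t, HasDerivAt f₃ (f₃' t) t) (h₄ : ∀ t, HasDerivAt f₄ (f₄' t) t)
    (h₅ : ∀ t, HasDerivAt f₅ (f₅' t) t)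
    (h : ∀ t, c₁ * (f₁ t * f₁' t) + c₂ * (f₂ t * f₂' t) + c₃ * (f₃ t * f₃' t)
      + c₄ * (f₄ t * f₄' t) + c₅ * (f₅ t * f₅' t) = 0) (s t : ℝ) :
    c₁ * f₁ s ^ 2 + c₂ * f₂ s ^ 2 + c₃ * f₃ s ^ 2 + c₄ * f₄ s ^ 2 + c₅ * f₅ s ^ 2
      = c₁ * f₁ t ^ 2 + c₂ * f₂ t ^ 2 + c₃ * f₃ t ^ 2 + c₄ * f₄ t ^ 2 + c₅ * f₅ t ^ 2 := by
  have hd : ∀ x, HasDerivAt (fun x => c₁ * f₁ x ^ 2 + c₂ * f₂ x ^ 2 + c₃ * f₃ x ^ 2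
      + c₄ * f₄ x ^ 2 + c₅ * f₅ x ^ 2) 0 x := fun x => by
    refine (((((((h₁ x).fun_pow 2).const_mul c₁).fun_add (((h₂ x).fun_pow 2).const_mul c₂)).fun_add
      (((h₃ x).fun_pow 2).const_mul c₃)).fun_add (((h₄ x).fun_pow 2).const_mul c₄)).fun_add
      (((h₅ x).fun_pow 2).const_mul c₅)).congr_deriv ?_
    norm_num
    linear_combination 2 * h x
  exact is_const_of_deriv_eq_zero (fun x => (hd x).differentiableAt) (fun x => (hd x).deriv) s t

/-- Along any solution of the coupled rigid-body resonant Euler system, the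
energy `a_k² + a_m² + a_n² + a_m̃² + a_k̃²` and the helicity
`λ_k a_k² + λ_m a_m² + λ_n a_n² + λ_m̃ a_m̃² + λ_k̃ a_k̃²` are constant. -/
theorem energy_helicity_conserved_coupled_rigid_body
    (lk lm ln lkt lmt Γ Γt : ℝ)
    (ak am an amt akt : ℝ → ℝ)
    (hak : ∀ t, HasDerivAt ak ((lm - ln) * Γ * am t * an t) t)
    (ham : ∀ t, HasDerivAt am ((ln - lk) * Γ * an t * ak t) t)
    (han : ∀ t, HasDerivAt an
      ((lk - lm) * Γ * ak t * am t + (lkt - lmt) * Γt * akt t * amt t) t)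
    (hamt : ∀ t, HasDerivAt amt ((ln - lkt) * Γt * an t * akt t) t)
    (hakt : ∀ t, HasDerivAt akt ((lmt - ln) * Γt * amt t * an t) t) :
    (∀ t : ℝ, ak t ^ 2 + am t ^ 2 + an t ^ 2 + amt t ^ 2 + akt t ^ 2
        = ak 0 ^ 2 + am 0 ^ 2 + an 0 ^ 2 + amt 0 ^ 2 + akt 0 ^ 2) ∧
    (∀ t : ℝ, lk * ak t ^ 2 + lm * am t ^ 2 + ln * an t ^ 2
          + lmt * amt t ^ 2 + lkt * akt t ^ 2
        = lk * ak 0 ^ 2 + lm * am 0 ^ 2 + ln * an 0 ^ 2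
          + lmt * amt 0 ^ 2 + lkt * akt 0 ^ 2) := by
  constructor <;> intro t
  · simpa only [one_mul] using
      weighted_sum_sq_eq_of_hasDerivAt 1 1 1 1 1 hak ham han hamt hakt (fun _ => by ring) t 0
  · exact weighted_sum_sq_eq_of_hasDerivAt lk lm ln lmt lkt hak ham han hamt hakt
      (fun _ => by ring) t 0
end

section
/- Along any solution of the coupled rigid-body resonant Euler system with λ_n ≠ λ_k and λ_k̃ ≠ λ_n, the three quantities 𝓔₁ = a_k(t)² + (1−α)·a_m(t)², 𝓔₂ = a_n(t)² + α·a_m(t)² + (1−α̃)·a_m̃(t)², and 𝓔₃ = a_k̃(t)² + α̃·a_m̃(t)² are constant in t, where α = (λ_m−λ_k)/(λ_n−λ_k) and α̃ = (λ_m̃−λ_n)/(λ_k̃−λ_n). -/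
/-- A real function whose derivative vanishes everywhere equals its value at the origin. -/
theorem eq_apply_zero_of_hasDerivAt_eq_zero {f f' : ℝ → ℝ} (hf : ∀ t, HasDerivAt f (f' t) t)
    (hf' : ∀ t, f' t = 0) (t : ℝ) : f t = f 0 :=
  is_const_of_deriv_eq_zero (fun s => (hf s).differentiableAt)
    (fun s => (hf s).deriv.trans (hf' s)) t 0

/-- Along any solution of the coupled rigid-body resonant Euler system with
`λ_n ≠ λ_k` and `λ_k̃ ≠ λ_n`, the three quantities
`𝓔₁ = a_k² + (1−α)a_m²`, `𝓔₂ = a_n² + α a_m² + (1−α̃)a_m̃²`,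
`𝓔₃ = a_k̃² + α̃ a_m̃²` are constant in time, where
`α = (λ_m−λ_k)/(λ_n−λ_k)` and `α̃ = (λ_m̃−λ_n)/(λ_k̃−λ_n)`. -/
theorem three_conservation_laws_coupled_rigid_body
    (lk lm ln lkt lmt Γ Γt : ℝ) (hnk : ln ≠ lk) (hktn : lkt ≠ ln)
    (ak am an amt akt : ℝ → ℝ)
    (hak : ∀ t, HasDerivAt ak ((lm - ln) * Γ * am t * an t) t)
    (ham : ∀ t, HasDerivAt am ((ln - lk) * Γ * an t * ak t) t)
    (han : ∀ t, HasDerivAt an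
      ((lk - lm) * Γ * ak t * am t + (lkt - lmt) * Γt * akt t * amt t) t)
    (hamt : ∀ t, HasDerivAt amt ((ln - lkt) * Γt * an t * akt t) t)
    (hakt : ∀ t, HasDerivAt akt ((lmt - ln) * Γt * amt t * an t) t)
    (α αt : ℝ)
    (hα : α = (lm - lk) / (ln - lk))
    (hαt : αt = (lmt - ln) / (lkt - ln)) :
    (∀ t : ℝ, ak t ^ 2 + (1 - α) * am t ^ 2 = ak 0 ^ 2 + (1 - α) * am 0 ^ 2) ∧
    (∀ t : ℝ, an t ^ 2 + α * am t ^ 2 + (1 - αt) * amt t ^ 2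
        = an 0 ^ 2 + α * am 0 ^ 2 + (1 - αt) * amt 0 ^ 2) ∧
    (∀ t : ℝ, akt t ^ 2 + αt * amt t ^ 2 = akt 0 ^ 2 + αt * amt 0 ^ 2) := by
  have hα' : α * (ln - lk) = lm - lk := by
    rw [hα, div_mul_cancel₀ _ (sub_ne_zero.mpr hnk)]
  have hαt' : αt * (lkt - ln) = lmt - ln := by
    rw [hαt, div_mul_cancel₀ _ (sub_ne_zero.mpr hktn)]
  refine ⟨eq_apply_zero_of_hasDerivAt_eq_zero
      (fun t => ((hak t).fun_pow 2).fun_add (((ham t).fun_pow 2).const_mul (1 - α))) fun t => ?_,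
    eq_apply_zero_of_hasDerivAt_eq_zero
      (fun t => (((han t).fun_pow 2).fun_add (((ham t).fun_pow 2).const_mul α)).fun_add
        (((hamt t).fun_pow 2).const_mul (1 - αt))) fun t => ?_,
    eq_apply_zero_of_hasDerivAt_eq_zero
      (fun t => ((hakt t).fun_pow 2).fun_add (((hamt t).fun_pow 2).const_mul αt)) fun t => ?_⟩
  · push_cast
    linear_combination (-2 * Γ * ak t * am t * an t) * hα'
  · push_cast
    linear_combination (2 * Γ * ak t * am t * an t) * hα' +
      (2 * Γt * akt t * amt t * an t) * hαt'
  · push_cast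
    linear_combination (-2 * Γt * akt t * amt t * an t) * hαt'
end

section
/- For the coupled rigid-body resonant Euler system with λ_n ≠ λ_k and λ_k̃ ≠ λ_n, the cone {a_n² + (1−α̃)a_m̃² = −α·a_m²} is invariant: if a solution satisfies a_n(0)² + α·a_m(0)² + (1−α̃)·a_m̃(0)² = 0, then a_n(t)² + (1−α̃)·a_m̃(t)² = −α·a_m(t)² for all t, where α = (λ_m−λ_k)/(λ_n−λ_k) and α̃ = (λ_m̃−λ_n)/(λ_k̃−λ_n). -/
/-- For the coupled rigid-body resonant Euler system with `λ_n ≠ λ_k` and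
`λ_k̃ ≠ λ_n`, the cone `{a_n² + (1−α̃)a_m̃² = −α·a_m²}` is invariant: if a
solution satisfies `a_n(0)² + α·a_m(0)² + (1−α̃)·a_m̃(0)² = 0`, then
`a_n(t)² + (1−α̃)·a_m̃(t)² = −α·a_m(t)²` for all `t`, where
`α = (λ_m−λ_k)/(λ_n−λ_k)` and `α̃ = (λ_m̃−λ_n)/(λ_k̃−λ_n)`. -/
theorem cone_invariance_coupled_rigid_body
    (lk lm ln lkt lmt Γ Γt : ℝ) (hnk : ln ≠ lk) (hktn : lkt ≠ ln)
    (ak am an amt akt : ℝ → ℝ)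
    (hak : ∀ t, HasDerivAt ak ((lm - ln) * Γ * am t * an t) t)
    (ham : ∀ t, HasDerivAt am ((ln - lk) * Γ * an t * ak t) t)
    (han : ∀ t, HasDerivAt an
      ((lk - lm) * Γ * ak t * am t + (lkt - lmt) * Γt * akt t * amt t) t)
    (hamt : ∀ t, HasDerivAt amt ((ln - lkt) * Γt * an t * akt t) t)
    (hakt : ∀ t, HasDerivAt akt ((lmt - ln) * Γt * amt t * an t) t)
    (α αt : ℝ)
    (hα : α = (lm - lk) / (ln - lk))
    (hαt : αt = (lmt - ln) / (lkt - ln))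
    (hcone0 : an 0 ^ 2 + α * am 0 ^ 2 + (1 - αt) * amt 0 ^ 2 = 0) :
    ∀ t : ℝ, an t ^ 2 + (1 - αt) * amt t ^ 2 = -α * am t ^ 2 := by
  have hα' : α * (ln - lk) = lm - lk := by
    rw [hα, div_mul_cancel₀ _ (sub_ne_zero.mpr hnk)]
  have hαt' : αt * (lkt - ln) = lmt - ln := by
    rw [hαt, div_mul_cancel₀ _ (sub_ne_zero.mpr hktn)]
  have hderiv : ∀ t, HasDerivAt
      (fun s => an s ^ 2 + α * am s ^ 2 + (1 - αt) * amt s ^ 2) 0 t := by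
    intro t
    refine HasDerivAt.congr_deriv ((((han t).fun_pow 2).fun_add (((ham t).fun_pow 2).const_mul α)).fun_add
      (((hamt t).fun_pow 2).const_mul (1 - αt))) ?_
    push_cast
    linear_combination (2 * Γ * am t * an t * ak t) * hα' +
      (2 * Γt * amt t * an t * akt t) * hαt'
  intro t
  have hconst := is_const_of_deriv_eq_zero (fun s => (hderiv s).differentiableAt)
    (fun s => (hderiv s).deriv) t 0
  simp only [hcone0] at hconst
  linear_combination hconst
end

section
/- Let θ > 0 and h_k, h_m, h_n ≥ 0, and suppose that for some choice of signs ε₁, ε₂, ε₃ ∈ {+1, −1} the three-wave resonance relation ε₁/√(θ + h_k) + ε₂/√(θ + h_m) + ε₃/√(θ + h_n) = 0 holds. Then θ is a root of the quartic polynomial P̃(θ) = −3θ⁴ − 4(h_k + h_m + h_n)θ³ − 6(h_k h_m + h_k h_n + h_m h_n)θ² − 12 h_k h_m h_n θ + (h_m²h_n² + h_k²h_n² + h_m²h_k² − 2(h_k h_m h_n² + h_k h_n h_m² + h_m h_n h_k²)). -/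
/-- The square of a signed inverse square root, with denominators cleared. -/
lemma sign_div_sqrt_sq_mul {ε A : ℝ} (hε : ε = 1 ∨ ε = -1) (hA : 0 < A) :
    (ε / Real.sqrt A) ^ 2 * A = 1 := by
  rw [div_pow, Real.sq_sqrt hA.le, div_mul_cancel₀ _ hA.ne']
  rcases hε with rfl | rfl <;> norm_num

/-- If three reals sum to zero, the reciprocals of their squares satisfy a quartic relation. -/
lemma quartic_of_add_eq_zero {a b c A B C : ℝ} (h : a + b + c = 0)
    (ha : a ^ 2 * A = 1) (hb : b ^ 2 * B = 1) (hc : c ^ 2 * C = 1) :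
    A ^ 2 * B ^ 2 + B ^ 2 * C ^ 2 + A ^ 2 * C ^ 2 - 2 * (A * B * C) * (A + B + C) = 0 := by
  have ha0 : a ≠ 0 := by rintro rfl; simp at ha
  have hb0 : b ≠ 0 := by rintro rfl; simp at hb
  have hc0 : c ≠ 0 := by rintro rfl; simp at hc
  obtain rfl : A = 1 / a ^ 2 := by field_simp; linarith
  obtain rfl : B = 1 / b ^ 2 := by field_simp; linarith
  obtain rfl : C = 1 / c ^ 2 := by field_simp; linarith
  field_simp
  obtain rfl : c = -a - b := by linarith
  ring

/-- If `θ > 0`, `h_k, h_m, h_n ≥ 0` and the three-wave resonance relation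
`ε₁/√(θ+h_k) + ε₂/√(θ+h_m) + ε₃/√(θ+h_n) = 0` holds for some signs
`ε_i ∈ {+1,−1}`, then `θ` is a root of the quartic polynomial
`P̃(θ) = −3θ⁴ − 4(h_k+h_m+h_n)θ³ − 6(h_kh_m+h_kh_n+h_mh_n)θ² − 12h_kh_mh_nθ
  + (h_m²h_n² + h_k²h_n² + h_m²h_k² − 2(h_kh_mh_n² + h_kh_nh_m² + h_mh_nh_k²))`. -/
theorem resonance_relation_implies_quartic_root
    (θ hk hm hn : ℝ) (hθ : 0 < θ) (hhk : 0 ≤ hk) (hhm : 0 ≤ hm) (hhn : 0 ≤ hn)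
    (ε₁ ε₂ ε₃ : ℝ)
    (hε₁ : ε₁ = 1 ∨ ε₁ = -1) (hε₂ : ε₂ = 1 ∨ ε₂ = -1) (hε₃ : ε₃ = 1 ∨ ε₃ = -1)
    (hres : ε₁ / Real.sqrt (θ + hk) + ε₂ / Real.sqrt (θ + hm)
        + ε₃ / Real.sqrt (θ + hn) = 0) :
    -3 * θ ^ 4 - 4 * (hk + hm + hn) * θ ^ 3
      - 6 * (hk * hm + hk * hn + hm * hn) * θ ^ 2
      - 12 * hk * hm * hn * θ
      + (hm ^ 2 * hn ^ 2 + hk ^ 2 * hn ^ 2 + hm ^ 2 * hk ^ 2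
        - 2 * (hk * hm * hn ^ 2 + hk * hn * hm ^ 2 + hm * hn * hk ^ 2)) = 0 := by
  have h := quartic_of_add_eq_zero hres
    (sign_div_sqrt_sq_mul hε₁ (by positivity)) (sign_div_sqrt_sq_mul hε₂ (by positivity))
    (sign_div_sqrt_sq_mul hε₃ (by positivity))
  linear_combination h
end

section
/- For every ε > 0 there exists δ > 0 such that for all reals x₋ < x₀ < x₊ with 1 − (x₊−x₀)/(x₊−x₋) < δ, the elliptic integral I = ∫_{x₀}^{x₊} dx/√((x−x₋)(x−x₀)(x₊−x)) and the quantity J = (1/√(x₊−x₋))·ln(1/(1 − √((x₊−x₀)/(x₊−x₋)))) satisfy |I/J − 1| < ε; i.e. I ∼ J uniformly in x₋, x₀, x₊ as (x₊−x₀)/(x₊−x₋) → 1. -/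
open Set Filter Topology MeasureTheory in
/-- A function squeezed between two nonnegative derivatives on an open interval has its integral
squeezed between the corresponding increments. -/
lemma integral_mem_Icc_of_hasDerivAt {f F G F' G' : ℝ → ℝ} {a b : ℝ} (hab : a ≤ b)
    (hf : Measurable f) (hF : ContinuousOn F (Icc a b)) (hG : ContinuousOn G (Icc a b))
    (hF' : ∀ x ∈ Ioo a b, HasDerivAt F (F' x) x) (hG' : ∀ x ∈ Ioo a b, HasDerivAt G (G' x) x)
    (h0 : ∀ x ∈ Ioo a b, 0 ≤ F' x) (hFf : ∀ x ∈ Ioo a b, F' x ≤ f x)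
    (hfG : ∀ x ∈ Ioo a b, f x ≤ G' x) :
    (∫ x in a..b, f x) ∈ Icc (F b - F a) (G b - G a) := by
  have iF : IntervalIntegrable F' volume a b :=
    (intervalIntegrable_iff_integrableOn_Ioc_of_le hab).2
      (intervalIntegral.integrableOn_deriv_of_nonneg hF hF' h0)
  have iG : IntervalIntegrable G' volume a b :=
    (intervalIntegrable_iff_integrableOn_Ioc_of_le hab).2
      (intervalIntegral.integrableOn_deriv_of_nonneg hG hG'
        fun x hx => (h0 x hx).trans ((hFf x hx).trans (hfG x hx)))
  have i_f : IntervalIntegrable f volume a b := by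
    rw [intervalIntegrable_iff_integrableOn_Ioo_of_le hab] at iG ⊢
    refine iG.mono' hf.aestronglyMeasurable ?_
    filter_upwards [ae_restrict_mem measurableSet_Ioo] with x hx
    rw [Real.norm_of_nonneg ((h0 x hx).trans (hFf x hx))]
    exact hfG x hx
  rw [← intervalIntegral.integral_eq_sub_of_hasDerivAt_of_le hab hF hF' iF,
    ← intervalIntegral.integral_eq_sub_of_hasDerivAt_of_le hab hG hG' iG]
  exact ⟨intervalIntegral.integral_mono_on_of_le_Ioo hab iF i_f hFf,
    intervalIntegral.integral_mono_on_of_le_Ioo hab i_f iG hfG⟩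

lemma one_div_mul_le_add {A p q r : ℝ} (hA : 0 < A) (hp : 0 < p) (hr : 0 < r) (hpq : p ≤ q)
    (h : p ^ 2 + r ^ 2 = A ^ 2) :
    1 / (q * p * r) ≤ 1 / (A * (p * q)) + 1 / (A ^ 2 * r) := by
  have hq : 0 < q := hp.trans_le hpq
  have hrA : r ≤ A := by nlinarith
  rw [div_add_div _ _ (by positivity) (by positivity), div_le_div_iff₀ (by positivity)
    (by positivity)]
  have key : 0 ≤ A * r + p * q - A ^ 2 := by nlinarith
  have : 0 ≤ (A * r + p * q - A ^ 2) * (A * p * q * r) := by positivity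
  nlinarith

open Set in
/-- Explicit two-sided bounds for the elliptic integral. -/
lemma elliptic_integral_mem_Icc {xm x0 xp : ℝ} (h₁ : xm < x0) (h₂ : x0 < xp) :
    (∫ x in x0..xp, 1 / √((x - xm) * (x - x0) * (xp - x))) ∈
      Icc (2 / √(xp - x0) * (Real.log (√(xp - x0) + √(xp - xm)) - Real.log √(x0 - xm)))
        (2 / √(xp - x0) * (Real.log (√(xp - x0) + √(xp - xm)) - Real.log √(x0 - xm) + 1)) := by
  set A := √(xp - x0) with hA
  have hA0 : 0 < A := Real.sqrt_pos.2 (sub_pos.2 h₂)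
  have hA2 : A ^ 2 = xp - x0 := Real.sq_sqrt (sub_pos.2 h₂).le
  let F : ℝ → ℝ := fun x => 2 / A * Real.log (√(x - x0) + √(x - xm))
  let G : ℝ → ℝ := fun x => F x - 2 / A ^ 2 * √(xp - x)
  have hF : ContinuousOn F (Icc x0 xp) := by
    refine continuousOn_const.mul (ContinuousOn.log (by fun_prop) fun x hx => ?_)
    have : 0 < √(x - xm) := Real.sqrt_pos.2 (by linarith [hx.1])
    positivity
  have hG : ContinuousOn G (Icc x0 xp) := hF.sub (by fun_prop)
  have hF' : ∀ x ∈ Ioo x0 xp, HasDerivAt F (1 / (A * (√(x - x0) * √(x - xm)))) x := by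
    intro x hx
    have h0 : 0 < x - x0 := sub_pos.2 hx.1
    have hm : 0 < x - xm := by linarith
    have hp := Real.sqrt_pos.2 h0
    have hq := Real.sqrt_pos.2 hm
    have := ((((hasDerivAt_id x).sub_const x0).sqrt h0.ne').add
      (((hasDerivAt_id x).sub_const xm).sqrt hm.ne')).log (by simp only [Pi.add_apply, id]; positivity)
    refine HasDerivAt.congr_deriv (f := F) (this.const_mul (2 / A)) ?_
    simp only [Pi.add_apply, id]
    field_simp
    ring
  have hG' : ∀ x ∈ Ioo x0 xp, HasDerivAt G
      (1 / (A * (√(x - x0) * √(x - xm))) + 1 / (A ^ 2 * √(xp - x))) x := by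
    intro x hx
    have h0 : 0 < xp - x := sub_pos.2 hx.2
    have hr := Real.sqrt_pos.2 h0
    have := (((hasDerivAt_id x).const_sub xp).sqrt h0.ne').const_mul (2 / A ^ 2)
    refine HasDerivAt.congr_deriv (f := G) ((hF' x hx).sub this) ?_
    simp only [id]
    field_simp
    ring
  have hsplit : ∀ x ∈ Ioo x0 xp, √((x - xm) * (x - x0) * (xp - x)) =
      √(x - xm) * √(x - x0) * √(xp - x) := by
    intro x hx
    have h0 : 0 ≤ x - x0 := (sub_pos.2 hx.1).le
    have hm : 0 ≤ x - xm := by linarith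
    rw [Real.sqrt_mul (mul_nonneg hm h0), Real.sqrt_mul hm]
  have key := integral_mem_Icc_of_hasDerivAt (f := fun x => 1 / √((x - xm) * (x - x0) * (xp - x)))
    h₂.le (by fun_prop) hF hG hF' hG' (fun x _ => by positivity) ?_ ?_
  · have e1 : F xp - F x0 = 2 / A * (Real.log (A + √(xp - xm)) - Real.log √(x0 - xm)) := by
      simp only [F, sub_self, Real.sqrt_zero, zero_add, ← hA]
      ring
    have e2 : G xp - G x0 =
        2 / A * (Real.log (A + √(xp - xm)) - Real.log √(x0 - xm) + 1) := by
      have : G xp - G x0 = F xp - F x0 + 2 / A ^ 2 * A := by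
        simp only [G, sub_self, Real.sqrt_zero, ← hA]
        ring
      rw [this, e1]
      field_simp
    rwa [e1, e2] at key
  · intro x hx
    have hp : 0 < √(x - x0) := Real.sqrt_pos.2 (sub_pos.2 hx.1)
    have hq : 0 < √(x - xm) := Real.sqrt_pos.2 (by linarith [hx.1])
    have hr : 0 < √(xp - x) := Real.sqrt_pos.2 (sub_pos.2 hx.2)
    have hrA : √(xp - x) ≤ A := Real.sqrt_le_sqrt (by linarith [hx.1])
    simp only [hsplit x hx]
    apply one_div_le_one_div_of_le (by positivity)
    rw [mul_comm A, mul_comm √(x - x0)]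
    gcongr
  · intro x hx
    simp only [hsplit x hx]
    refine one_div_mul_le_add hA0 (Real.sqrt_pos.2 (sub_pos.2 hx.1))
      (Real.sqrt_pos.2 (sub_pos.2 hx.2)) (Real.sqrt_le_sqrt (by linarith)) ?_
    rw [hA2, Real.sq_sqrt (sub_pos.2 hx.1).le, Real.sq_sqrt (sub_pos.2 hx.2).le]
    ring

lemma two_mul_log_sub_log_sqrt {A L m : ℝ} (hA : 0 < A) (hL : 0 < L) (hm : 0 < m)
    (h : m = L ^ 2 - A ^ 2) :
    2 * (Real.log (A + L) - Real.log √m) =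
      Real.log (1 + A / L) + Real.log (1 / (1 - A / L)) := by
  have hAL : A < L := by nlinarith
  have hk : 0 < 1 - A / L := sub_pos.2 ((div_lt_one hL).2 hAL)
  have hLA : L - A ≠ 0 := (sub_pos.2 hAL).ne'
  rw [Real.log_sqrt hm.le, ← Real.log_mul (by positivity) (by positivity)]
  have e : (1 + A / L) * (1 / (1 - A / L)) = (A + L) ^ 2 / m := by
    have h1 : 1 - A / L = (L - A) / L := by field_simp
    have h2 : m = (L - A) * (L + A) := by rw [h]; ring
    rw [h1, h2]
    field_simp
    ring
  rw [e, Real.log_div (by positivity) hm.ne', Real.log_pow]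
  push_cast
  ring

open Filter Topology in
lemma tendsto_inv_mul_one_add_div_log :
    Tendsto (fun s : ℝ => 1 / √(1 - s) * (1 + 3 / Real.log (1 / (1 - √(1 - s)))))
      (𝓝[>] 0) (𝓝 1) := by
  have hs : Tendsto (fun s : ℝ => √(1 - s)) (𝓝[>] 0) (𝓝 1) := by
    have : Continuous fun s : ℝ => √(1 - s) := by fun_prop
    simpa using (this.tendsto 0).mono_left nhdsWithin_le_nhds
  have h0 : Tendsto (fun s : ℝ => 1 - √(1 - s)) (𝓝[>] 0) (𝓝[>] 0) := by
    refine tendsto_nhdsWithin_iff.2 ⟨by simpa using hs.const_sub 1, ?_⟩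
    filter_upwards [self_mem_nhdsWithin] with s (hs : 0 < s)
    exact sub_pos.2 ((Real.sqrt_lt' one_pos).2 (by linarith))
  have hlog : Tendsto (fun s : ℝ => Real.log (1 / (1 - √(1 - s)))) (𝓝[>] 0) atTop := by
    simp only [one_div]
    exact Real.tendsto_log_atTop.comp (tendsto_inv_nhdsGT_zero.comp h0)
  simpa using ((tendsto_const_nhds (x := (1 : ℝ))).div hs one_ne_zero).mul ((hlog.const_div_atTop 3).const_add 1)

/-- Asymptotics of the elliptic integral in the modulus-1 limit: uniformly in
`x₋ < x₀ < x₊`, as `(x₊−x₀)/(x₊−x₋) → 1`,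
`∫_{x₀}^{x₊} dx/√((x−x₋)(x−x₀)(x₊−x))
  ∼ (1/√(x₊−x₋))·ln(1/(1 − √((x₊−x₀)/(x₊−x₋))))`. -/
theorem elliptic_integral_asymptotics :
    ∀ ε : ℝ, 0 < ε → ∃ δ : ℝ, 0 < δ ∧
      ∀ xm x0 xp : ℝ, xm < x0 → x0 < xp →
        1 - (xp - x0) / (xp - xm) < δ →
        |(∫ x in x0..xp, 1 / Real.sqrt ((x - xm) * (x - x0) * (xp - x))) /
            ((1 / Real.sqrt (xp - xm)) *
              Real.log (1 / (1 - Real.sqrt ((xp - x0) / (xp - xm))))) - 1| < ε := by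
  intro ε hε
  have hev := tendsto_inv_mul_one_add_div_log.eventually (gt_mem_nhds (lt_add_of_pos_right 1 hε))
  obtain ⟨δ, hδ, hsub⟩ := mem_nhdsGT_iff_exists_Ioo_subset.1 hev
  refine ⟨δ, hδ, fun xm x0 xp h₁ h₂ h => ?_⟩
  have ha : 0 < xp - x0 := sub_pos.2 h₂
  have hl : 0 < xp - xm := by linarith
  have hu : (xp - x0) / (xp - xm) < 1 := (div_lt_one hl).2 (by linarith)
  have hbound := hsub ⟨sub_pos.2 hu, h⟩
  simp only [Set.mem_ofPred_eq, sub_sub_cancel] at hbound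
  obtain ⟨hlo, hhi⟩ := elliptic_integral_mem_Icc h₁ h₂
  set I := ∫ x in x0..xp, 1 / √((x - xm) * (x - x0) * (xp - x))
  rw [Real.sqrt_div ha.le] at hbound ⊢
  have hid := two_mul_log_sub_log_sqrt (Real.sqrt_pos.2 ha) (Real.sqrt_pos.2 hl)
    (sub_pos.2 h₁) (by rw [Real.sq_sqrt ha.le, Real.sq_sqrt hl.le]; ring)
  have hA : 0 < √(xp - x0) := Real.sqrt_pos.2 ha
  have hL : 0 < √(xp - xm) := Real.sqrt_pos.2 hl
  have hAL : √(xp - x0) < √(xp - xm) := Real.sqrt_lt_sqrt ha.le (by linarith)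
  set A := √(xp - x0)
  set L := √(xp - xm)
  have hk0 : 0 < A / L := by positivity
  have hk1 : A / L < 1 := (div_lt_one hL).2 hAL
  have hlog0 : 0 ≤ Real.log (1 + A / L) := Real.log_nonneg (by linarith)
  have hlog1 : Real.log (1 + A / L) ≤ 1 := by
    linarith [Real.log_le_sub_one_of_pos (show 0 < 1 + A / L by positivity)]
  have hΛ : 0 < Real.log (1 / (1 - A / L)) :=
    Real.log_pos ((one_lt_div (by linarith)).2 (by linarith))
  set Λ := Real.log (1 / (1 - A / L))
  have hI1 : Λ / A ≤ I := by
    refine le_trans ?_ hlo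
    rw [div_mul_eq_mul_div, hid]
    exact div_le_div_of_nonneg_right (by linarith) hA.le
  have hI2 : I ≤ (Λ + 3) / A := by
    refine hhi.trans ?_
    rw [div_mul_eq_mul_div, mul_add, hid]
    exact div_le_div_of_nonneg_right (by linarith) hA.le
  have hJ : 0 < 1 / L * Λ := by positivity
  have h1 : 1 ≤ I / (1 / L * Λ) := by
    rw [one_le_div hJ, div_mul_eq_mul_div, one_mul]
    exact (div_le_div_of_nonneg_left hΛ.le hA hAL.le).trans hI1
  have h2 : I / (1 / L * Λ) ≤ 1 / (A / L) * (1 + 3 / Λ) := by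
    rw [div_le_iff₀ hJ]
    refine hI2.trans_eq ?_
    field_simp
  rw [abs_lt]
  constructor <;> linarith
end
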